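/- In the moment-like curve construction with d ≥ 4, there exists τ̂_{[3]} > 0 such that for all τ ∈ (0, τ̂_{[3]}) and all 3 ≤ k ≤ ⌊(d+2)/2⌋, f_{k−1}(ℱ_{[3]}) = Σ_{∅⊂S⊆[3]} (−1)^{3−|S|} C(n_S, k); equivalently, every set of k vertices of the Cayley polytope 𝒞 containing at least one vertex from each of 𝒱_1, 𝒱_2, 𝒱_3 is the vertex set of a (k−1)-face of 𝒞. -/

import Mathlib

open Finset Pointwise

noncomputable section

/-- The ambient space `ℝ^d`. -/
abbrev Vec (d : ℕ) := Fin d → ℝ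

/-- Dimension of a set of points: the dimension of its affine span,
with the convention that the empty set has dimension `-1`. -/
noncomputable def sdim {D : ℕ} (s : Set (Vec D)) : ℤ :=
  open scoped Classical in
  if s = ∅ then -1 else (Module.finrank ℝ (affineSpan ℝ s).direction : ℤ)

/-- `F` is a proper (nonempty) face of `P`: a nonempty exposed face distinct from `P`. -/
def IsProperFace {D : ℕ} (P F : Set (Vec D)) : Prop :=
  IsExposed ℝ P F ∧ F.Nonempty ∧ F ≠ P

/-- The number of `k`-dimensional (proper, nonempty) faces of `P`. -/
noncomputable def fPoly {D : ℕ} (P : Set (Vec D)) (k : ℤ) : ℕ :=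
  Nat.card {F : Set (Vec D) // IsProperFace P F ∧ sdim F = k}

/-- `P` is the (convex) polytope with vertex set `V`. -/
def IsPolytopeWithVertexSet {D : ℕ} (P : Set (Vec D)) (V : Finset (Vec D)) : Prop :=
  P = convexHull ℝ (V : Set (Vec D)) ∧
    ∀ v ∈ V, v ∉ convexHull ℝ ((V.erase v : Finset (Vec D)) : Set (Vec D))

/-- The (generalized) binomial coefficient `C(a,b)` for integers `a b`, equal to `0`
for `b < 0` (and, in particular, equal to `0` when `b > a ≥ 0`). -/
noncomputable def ch (a b : ℤ) : ℤ := if 0 ≤ b then Ring.choose a b.toNat else 0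

/-- The moment curve in `ℝ^m`. -/
def momentCurve (m : ℕ) (t : ℝ) : Vec m := fun i => t ^ ((i : ℕ) + 1)

/-- The cyclic polytope `C_m(N)`: the convex hull of `N` distinct points on the
moment curve in `ℝ^m`. -/
noncomputable def cyclicPolytope (m N : ℕ) : Set (Vec m) :=
  convexHull ℝ (Set.range fun j : Fin N => momentCurve m ((j : ℕ) + 1))

/-- The upper bound expression for `f_{k-1}(P₁+P₂+P₃)` from Theorem `thm:ms3ub`. -/
noncomputable def UB3 (d : ℕ) (n : Fin 3 → ℕ) (k : ℕ) : ℤ :=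
  (fPoly (cyclicPolytope (d + 2) (n 0 + n 1 + n 2)) ((k : ℤ) + 1) : ℤ) -
    (∑ i ∈ Finset.range ((d + 2) / 2 + 1),
      ch ((d : ℤ) + 2 - (i : ℤ)) ((k : ℤ) + 2 - (i : ℤ)) *
        ∑ S ∈ (Finset.univ : Finset (Fin 3)).powerset.filter
            (fun S => S ≠ ∅ ∧ S ≠ Finset.univ),
          (-1 : ℤ) ^ S.card * ch ((∑ j ∈ S, (n j : ℤ)) - (d : ℤ) - 3 + (i : ℤ)) (i : ℤ)) -
    ((d : ℤ) - 2 * ((d / 2 : ℕ) : ℤ)) *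
      ch (((d / 2 : ℕ) : ℤ) + 1) ((k : ℤ) - ((d / 2 : ℕ) : ℤ)) *
      ∑ i : Fin 3, ch ((n i : ℤ) - ((d / 2 : ℕ) : ℤ) - 2) (((d / 2 : ℕ) : ℤ) + 1)

/-! ### The Cayley construction for three polytopes -/

/-- The standard affine basis of `ℝ²` used in the Cayley embedding. -/
def e2 : Fin 3 → Vec 2 := ![![0, 0], ![1, 0], ![0, 1]]

/-- The Cayley embedding `v ↦ (e_{2,i}, v) ∈ ℝ^{2+d}` of `ℝ^d`. -/
def cayEmb (d : ℕ) (i : Fin 3) (v : Vec d) : Vec (2 + d) := Fin.append (e2 i) v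

/-- The number of `k`-dimensional members of a set of faces. -/
noncomputable def fsetCount {D : ℕ} (Y : Set (Set (Vec D))) (k : ℤ) : ℕ :=
  Nat.card {F : Set (Vec D) // F ∈ Y ∧ sdim F = k}

/-- A set of points which is a (geometric) simplex: the convex hull of an affinely
independent finite set. -/
def IsSimplexSet {D : ℕ} (F : Set (Vec D)) : Prop :=
  ∃ A : Finset (Vec D), AffineIndependent ℝ (fun v : A => (v : Vec D)) ∧
    F = convexHull ℝ (A : Set (Vec D))

/-- Data of three `d`-polytopes in `ℝ^d`, each of dimension `d`,
given by their vertex sets, each having at least `d+1` vertices. -/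
structure Cayley3 (d : ℕ) where
  hd : 2 ≤ d
  V : Fin 3 → Finset (Vec d)
  hcard : ∀ i, d + 1 ≤ (V i).card
  hvert : ∀ i, IsPolytopeWithVertexSet (convexHull ℝ ((V i : Set (Vec d)))) (V i)
  hdim : ∀ i, sdim (convexHull ℝ ((V i : Set (Vec d)))) = (d : ℤ)

namespace Cayley3

variable {d : ℕ} (Γ : Cayley3 d)

/-- The polytope `P i`. -/
noncomputable def P (i : Fin 3) : Set (Vec d) := convexHull ℝ ((Γ.V i : Set (Vec d)))

/-- The Cayley-embedded vertex set `𝒱_i ⊆ ℝ^{2+d}`. -/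
noncomputable def VV (i : Fin 3) : Finset (Vec (2 + d)) := (Γ.V i).image (cayEmb d i)

/-- The Cayley polytope `𝒞 = conv(𝒱₁ ∪ 𝒱₂ ∪ 𝒱₃)`. -/
noncomputable def Cay : Set (Vec (2 + d)) :=
  convexHull ℝ ((↑(Γ.VV 0 ∪ Γ.VV 1 ∪ Γ.VV 2) : Set (Vec (2 + d))))

/-- The Cayley polytope `𝒞_R = conv(∪_{i∈R} 𝒱_i)`. -/
noncomputable def CayR (R : Finset (Fin 3)) : Set (Vec (2 + d)) :=
  convexHull ℝ ((↑(R.biUnion Γ.VV) : Set (Vec (2 + d))))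

/-- `ℱ_R`: the set of proper faces of `𝒞` having at least one vertex in each `𝒱_i`, `i ∈ R`. -/
def FSet (R : Finset (Fin 3)) : Set (Set (Vec (2 + d))) :=
  {F | IsProperFace Γ.Cay F ∧ ∀ i ∈ R, (F ∩ (↑(Γ.VV i) : Set (Vec (2 + d)))).Nonempty}

/-- `𝒦_R`: the closure of `ℱ_R` under taking faces (together with the empty face). -/
def KSet (R : Finset (Fin 3)) : Set (Set (Vec (2 + d))) :=
  {G | G = ∅ ∨ (IsProperFace Γ.Cay G ∧ ∃ F ∈ Γ.FSet R, G ⊆ F)}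

/-- The face numbers `f_k(ℱ_R)`, with the conventions `f_{-1}(ℱ_R) = (-1)^{|R|-1}` and
`f_k(ℱ_R) = 0` for `k < -1` or `k > d + |R| - 2`. -/
noncomputable def fF (R : Finset (Fin 3)) (k : ℤ) : ℤ :=
  if k < -1 ∨ (d : ℤ) + R.card - 2 < k then 0
  else if k = -1 then (-1 : ℤ) ^ (R.card - 1)
  else (fsetCount (Γ.FSet R) k : ℤ)

/-- The face numbers `f_k(𝒦_R)`. -/
noncomputable def fK (R : Finset (Fin 3)) (k : ℤ) : ℤ := (fsetCount (Γ.KSet R) k : ℤ)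

/-- `𝒞` is "as simplicial as possible": every proper face of `𝒞` other than the
trivial faces `𝒞_R`, `∅ ⊂ R ⊆ [3]`, is a simplex. -/
def Simplicial : Prop :=
  ∀ F : Set (Vec (2 + d)), IsProperFace Γ.Cay F →
    (∀ R : Finset (Fin 3), R.Nonempty → F ≠ Γ.CayR R) → IsSimplexSet F

end Cayley3

/-- The `h`-vector associated with an `f`-vector function `fv` and a face set of
maximal dimension `δ`:  `h_k = ∑_{i=0}^{δ+1} (-1)^{k-i} C(δ+1-i, δ+1-k) f_{i-1}`. -/
noncomputable def hF (fv : ℤ → ℤ) (δ : ℤ) (k : ℤ) : ℤ :=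
  ∑ i ∈ Finset.range (δ + 2).toNat,
    (-1 : ℤ) ^ (k - (i : ℤ)).natAbs * ch (δ + 1 - (i : ℤ)) (δ + 1 - k) * fv ((i : ℤ) - 1)

/-- The `m`-order `g`-vector: `g^{(0)} = h` and `g_k^{(m)} = g_k^{(m-1)} - g_{k-1}^{(m-1)}`. -/
noncomputable def gF (fv : ℤ → ℤ) (δ : ℤ) : ℕ → ℤ → ℤ
  | 0 => hF fv δ
  | m + 1 => fun k => gF fv δ m k - gF fv δ m (k - 1)

/-- The link of a vertex `v` in a face set `Y`: the faces `F ∈ Y` not containing `v`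
such that the join of `v` and `F` is again in `Y`. -/
def linkv {D : ℕ} (Y : Set (Set (Vec D))) (v : Vec D) : Set (Set (Vec D)) :=
  {F ∈ Y | v ∉ F ∧ convexHull ℝ ({v} ∪ F) ∈ Y}

/-- The `f`-vector function of a face set. -/
noncomputable def fvOf {D : ℕ} (Y : Set (Set (Vec D))) : ℤ → ℤ :=
  fun k => (fsetCount Y k : ℤ)

/-! ### The moment-like curve construction -/

/-- The moment-like curve `γ_i` in `ℝ^d` (`i ∈ [3]`, 0-indexed): its `(j+1)`-st coordinate is
`ζ t^{j+1}` if `j+1 ∈ {1,2,3}` is not the `(i+1)`-st position, and `t^{j+1}` otherwise. -/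
noncomputable def gamma3 (d : ℕ) (ζ : ℝ) (i : Fin 3) (t : ℝ) : Vec d :=
  fun j => (if (j : ℕ) < 3 ∧ (j : ℕ) ≠ (i : ℕ) then ζ else 1) * t ^ ((j : ℕ) + 1)

/-- The vertex set `V_i = {γ_i(x_{i,1} τ^{ν_i}), …, γ_i(x_{i,n_i} τ^{ν_i})}`, where
`ν_i = 3 - i` (1-indexed, i.e. `ν_1 = 2, ν_2 = 1, ν_3 = 0`) and `ζ = τ^M`. -/
noncomputable def Vtau (d : ℕ) (n : Fin 3 → ℕ) (x : (i : Fin 3) → Fin (n i) → ℝ)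
    (M : ℕ) (τ : ℝ) (i : Fin 3) : Finset (Vec d) :=
  (Finset.univ : Finset (Fin (n i))).image
    (fun j => gamma3 d (τ ^ M) i (x i j * τ ^ (2 - (i : ℕ))))

/-- The Cayley-embedded vertex set `𝒱_i ⊆ ℝ^{2+d}` of the construction. -/
noncomputable def VVtau (d : ℕ) (n : Fin 3 → ℕ) (x : (i : Fin 3) → Fin (n i) → ℝ)
    (M : ℕ) (τ : ℝ) (i : Fin 3) : Finset (Vec (2 + d)) :=
  (Vtau d n x M τ i).image (cayEmb d i)

/-- The Cayley polytope `𝒞` of the construction. -/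
noncomputable def Ctau (d : ℕ) (n : Fin 3 → ℕ) (x : (i : Fin 3) → Fin (n i) → ℝ)
    (M : ℕ) (τ : ℝ) : Set (Vec (2 + d)) :=
  convexHull ℝ
    ((↑(VVtau d n x M τ 0 ∪ VVtau d n x M τ 1 ∪ VVtau d n x M τ 2) : Set (Vec (2 + d))))

/-- `ℱ_R` for the construction: the proper faces of `𝒞` having at least one vertex in
each `𝒱_i`, `i ∈ R`. -/
def Ftau (d : ℕ) (n : Fin 3 → ℕ) (x : (i : Fin 3) → Fin (n i) → ℝ)
    (M : ℕ) (τ : ℝ) (R : Finset (Fin 3)) : Set (Set (Vec (2 + d))) :=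
  {F | IsProperFace (Ctau d n x M τ) F ∧
    ∀ i ∈ R, (F ∩ (↑(VVtau d n x M τ i) : Set (Vec (2 + d)))).Nonempty}

section SparsePolynomials

open Polynomial

/-- The number of sign variations of a nonzero real polynomial is less than its number of terms. -/
lemma signVariations_lt_card_support {P : ℝ[X]} (hP : P ≠ 0) :
    P.signVariations < #P.support := by
  generalize hN : #P.support = N
  induction N generalizing P with
  | zero => simp_all
  | succ N ih =>
    have hc : #P.eraseLead.support = N := card_support_eraseLead' hN
    by_cases h0 : P.eraseLead = 0
    · have := signVariations_eq_eraseLead_add_ite hP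
      have hlead : SignType.sign P.leadingCoeff ≠ 0 := by simp [hP]
      simp [h0, hP] at this
      omega
    · have := ih h0 hc
      have := signVariations_le_eraseLead_succ (P := P)
      omega

/-- If a real polynomial has as many sign variations as possible, then its coefficients
alternate. -/
lemma alternating_of_signVariations {P : ℝ[X]} (hP : P.signVariations + 1 = #P.support) {e : ℕ}
    (he : e ∈ P.support) :
    0 < (-1) ^ #(P.support.filter (e < ·)) * P.leadingCoeff * P.coeff e := by
  generalize hN : #P.support = N
  induction N generalizing P with
  | zero => simp_all
  | succ N ih =>
    have hP0 : P ≠ 0 := by rintro rfl; simp at he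
    have hc : #P.eraseLead.support = N := card_support_eraseLead' hN
    by_cases hed : e = P.natDegree
    · have : P.support.filter (e < ·) = ∅ := by
        ext j
        simp only [mem_filter, mem_support_iff, Finset.notMem_empty, iff_false, not_and, not_lt]
        intro hj
        rw [hed]
        exact le_natDegree_of_ne_zero hj
      rw [this, hed]
      have : P.leadingCoeff ≠ 0 := by simpa using hP0
      simp only [Finset.card_empty, pow_zero, one_mul, coeff_natDegree]
      exact mul_self_pos.2 this
    · have he' : e ∈ P.eraseLead.support := by
        rw [mem_support_iff, eraseLead_coeff_of_ne _ hed]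
        simpa using he
      have h0 : P.eraseLead ≠ 0 := by
        intro h
        simp [h] at he'
      have h1 := signVariations_lt_card_support h0
      have h2 := signVariations_eq_eraseLead_add_ite hP0
      have hs : SignType.sign P.leadingCoeff = -SignType.sign P.eraseLead.leadingCoeff := by
        by_contra hcon
        rw [if_neg hcon] at h2
        omega
      rw [if_pos hs] at h2
      have h3 := ih (P := P.eraseLead) (by omega) he' hc
      have h4 : #(P.support.filter (e < ·)) = #(P.eraseLead.support.filter (e < ·)) + 1 := by
        rw [eraseLead_support, filter_erase, Finset.card_erase_add_one]
        simp only [mem_filter]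
        exact ⟨natDegree_mem_support_of_nonzero hP0,
          lt_of_le_of_ne (le_natDegree_of_mem_supp _ he) hed⟩
      rw [eraseLead_coeff_of_ne _ hed] at h3
      have h5 : P.eraseLead.leadingCoeff ≠ 0 := by simpa using h0
      have h6 : P.leadingCoeff ≠ 0 := by simpa using hP0
      have h7 : P.leadingCoeff * P.eraseLead.leadingCoeff < 0 := by
        rw [← sign_eq_neg_one_iff, sign_mul, hs]
        rcases lt_or_gt_of_ne h5 with h | h <;> simp [h]
      rw [h4, pow_succ]
      have h8 : 0 < P.eraseLead.leadingCoeff ^ 2 := by positivity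
      nlinarith [mul_pos (neg_pos.2 h7) h3]

/-- The polynomial with exponents in `E` and prescribed coefficients, as a linear map. -/
def sparsePoly (E : Finset ℕ) : (E → ℝ) →ₗ[ℝ] ℝ[X] :=
  ∑ e : E, (monomial (e : ℕ)) ∘ₗ LinearMap.proj e

lemma sparsePoly_coeff (E : Finset ℕ) (f : E → ℝ) (e : E) :
    (sparsePoly E f).coeff e = f e := by
  simp [sparsePoly, coeff_monomial]

lemma sparsePoly_support (E : Finset ℕ) (f : E → ℝ) : (sparsePoly E f).support ⊆ E := by
  intro j hj
  by_contra hjE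
  refine (mem_support_iff.1 hj) ?_
  simp only [sparsePoly, LinearMap.sum_apply, LinearMap.comp_apply, LinearMap.proj_apply,
    finsetSum_coeff, coeff_monomial]
  refine Finset.sum_eq_zero fun e _ => if_neg ?_
  rintro rfl
  exact hjE e.2

lemma sparsePoly_ne_zero (E : Finset ℕ) {f : E → ℝ} (hf : f ≠ 0) : sparsePoly E f ≠ 0 := by
  intro h
  refine hf (funext fun e => ?_)
  rw [← sparsePoly_coeff E f e, h]
  simp

/-- Interpolation by sparse polynomials at positive nodes. -/
lemma exists_sparse_interpolation (E : Finset ℕ) (X : Finset ℝ) (hX : ∀ y ∈ X, 0 < y)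
    (hcard : #E = #X) (v : ℝ → ℝ) :
    ∃ q : ℝ[X], q.support ⊆ E ∧ ∀ y ∈ X, q.eval y = v y := by
  let Φ : (E → ℝ) →ₗ[ℝ] (X → ℝ) := LinearMap.pi fun y => (leval (y : ℝ)) ∘ₗ sparsePoly E
  have hinj : Function.Injective Φ := by
    rw [← LinearMap.ker_eq_bot, LinearMap.ker_eq_bot']
    intro f hf
    by_contra hf0
    have hq := sparsePoly_ne_zero E hf0
    set q := sparsePoly E f
    have hroot : ∀ y ∈ X, q.IsRoot y := fun y hy => congrFun hf ⟨y, hy⟩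
    have h1 : X.val ≤ q.roots.filter (0 < ·) := by
      rw [Multiset.le_iff_subset X.nodup]
      intro y hy
      simp only [Multiset.mem_filter, mem_roots hq]
      exact ⟨hroot y hy, hX y hy⟩
    have h2 := Multiset.card_le_card h1
    rw [← Multiset.countP_eq_card_filter] at h2
    have h3 := roots_countP_pos_le_signVariations (P := q)
    have h4 := signVariations_lt_card_support hq
    have h5 := Finset.card_le_card (sparsePoly_support E f)
    have h6 : Multiset.card X.val = #X := rfl
    simp only [q] at *
    omega
  have hsurj : Function.Surjective Φ :=
    (LinearMap.injective_iff_surjective_of_finrank_eq_finrank (by simp [hcard])).1 hinj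
  obtain ⟨f, hf⟩ := hsurj fun y => v y
  exact ⟨sparsePoly E f, sparsePoly_support E f, fun y hy => congrFun hf ⟨y, hy⟩⟩

/-- A polynomial with positive leading coefficient and no positive root is positive on the
positive reals. -/
lemma eval_pos_of_no_pos_roots {g : ℝ[X]} (hlead : 0 < g.leadingCoeff)
    (hg : ∀ y, 0 < y → g.eval y ≠ 0) {y : ℝ} (hy : 0 < y) : 0 < g.eval y := by
  by_contra hneg
  have hneg : g.eval y < 0 := lt_of_le_of_ne (not_lt.1 hneg) (hg y hy)
  have hdeg : 0 < g.degree := by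
    by_contra hd
    have := eq_C_of_degree_le_zero (not_lt.1 hd)
    rw [this] at hneg hlead
    simp at hneg hlead
    linarith
  have ht := g.tendsto_atTop_of_leadingCoeff_nonneg hdeg hlead.le
  obtain ⟨z, hz0, hyz⟩ :=
    ((ht.eventually_gt_atTop 0).and (Filter.eventually_ge_atTop y)).exists
  obtain ⟨w, hw, hw0⟩ := intermediate_value_Icc hyz g.continuous.continuousOn
    (show (0 : ℝ) ∈ Set.Icc (g.eval y) (g.eval z) from ⟨hneg.le, hz0.le⟩)
  exact hg w (hy.trans_le hw.1) hw0

/-- A sparse polynomial with double roots at the points of `X`, nonnegative on the positive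
reals. -/
lemma exists_sparse_double_roots (i m : ℕ) (hi : 1 ≤ i) (him : i < m) (X : Finset ℝ)
    (hX : ∀ y ∈ X, 0 < y) (hXne : X.Nonempty) :
    ∃ q : ℝ[X], q.support ⊆ {0, i} ∪ Finset.Icc m (m + 2 * (#X - 1)) ∧
      (∀ y ∈ X, q.eval y = 0) ∧ (∀ y, 0 < y → y ∉ X → 0 < q.eval y) ∧
      0 < q.coeff m ∧ 0 < q.coeff (m + 2 * (#X - 1)) := by
  have hXpos : 0 < #X := hXne.card_pos
  set E : Finset ℕ := {0, i} ∪ Finset.Icc m (m + 2 * (#X - 1)) with hE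
  have hEcard : #E = 2 * #X + 1 := by
    rw [hE, Finset.card_union_of_disjoint, Nat.card_Icc, Finset.card_pair (by omega)]
    · omega
    · rw [Finset.disjoint_left]
      intro j hj
      simp only [Finset.mem_insert, Finset.mem_singleton] at hj
      simp only [Finset.mem_Icc]
      omega
  let Φ : (E → ℝ) →ₗ[ℝ] (X → ℝ) × (X → ℝ) :=
    (LinearMap.pi fun y : X => (leval (y : ℝ)) ∘ₗ sparsePoly E).prod
      (LinearMap.pi fun y : X => (leval (y : ℝ)) ∘ₗ derivative ∘ₗ sparsePoly E)
  obtain ⟨f, hf, hf0⟩ : ∃ f, Φ f = 0 ∧ f ≠ 0 := by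
    have := LinearMap.ker_ne_bot_of_finrank_lt (f := Φ) (by
      simp [hEcard]; omega)
    obtain ⟨f, hf, hf0⟩ := Submodule.exists_mem_ne_zero_of_ne_bot this
    exact ⟨f, hf, hf0⟩
  obtain ⟨q, hq0, hqE, hq1, hq2, hlead⟩ : ∃ q : ℝ[X], q ≠ 0 ∧ q.support ⊆ E ∧
      (∀ y ∈ X, q.IsRoot y) ∧ (∀ y ∈ X, (derivative q).IsRoot y) ∧ 0 < q.leadingCoeff := by
    have hq := sparsePoly_ne_zero E hf0
    have h1 : ∀ y ∈ X, (sparsePoly E f).IsRoot y :=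
      fun y hy => congrFun (congrArg Prod.fst hf) ⟨y, hy⟩
    have h2 : ∀ y ∈ X, (derivative (sparsePoly E f)).IsRoot y :=
      fun y hy => congrFun (congrArg Prod.snd hf) ⟨y, hy⟩
    rcases lt_or_gt_of_ne (leadingCoeff_ne_zero.2 hq) with h | h
    · refine ⟨-sparsePoly E f, by simpa using hq, by simpa using sparsePoly_support E f, ?_, ?_,
        by simpa using h⟩
      · intro y hy
        simpa [IsRoot.def] using h1 y hy
      · intro y hy
        simpa [IsRoot.def] using h2 y hy
    · exact ⟨_, hq, sparsePoly_support E f, h1, h2, h⟩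
  have hdvd : ∏ y ∈ X, (Polynomial.X - C y) ^ 2 ∣ q := by
    refine Finset.prod_dvd_of_coprime ?_ ?_
    · intro y _ z _ hyz
      exact IsCoprime.pow (pairwise_coprime_X_sub_C Function.injective_id hyz)
    · intro y hy
      refine (pow_dvd_pow _ ?_).trans (pow_rootMultiplicity_dvd q y)
      exact (one_lt_rootMultiplicity_iff_isRoot hq0).2 ⟨hq1 y hy, hq2 y hy⟩
  obtain ⟨g, hg⟩ := hdvd
  set D : ℝ[X] := ∏ y ∈ X, (Polynomial.X - C y) ^ 2 with hD
  have hDmonic : D.Monic := monic_prod_of_monic _ _ fun y _ => (monic_X_sub_C y).pow 2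
  have hg0 : g ≠ 0 := by
    rintro rfl
    simp [hq0] at hg
  have hDroots : D.roots = 2 • X.val := by
    rw [hD, Finset.prod_pow, roots_pow, roots_prod_X_sub_C]
  have hcount : q.roots.countP (0 < ·) = 2 * #X + g.roots.countP (0 < ·) := by
    rw [hg, roots_mul (hg ▸ hq0), Multiset.countP_add, hDroots, Multiset.countP_nsmul]
    congr 2
    exact Multiset.countP_eq_card.2 hX
  have hle := roots_countP_pos_le_signVariations (P := q)
  have hlt := signVariations_lt_card_support hq0
  have hcardle := Finset.card_le_card hqE
  have hsupp : q.support = E := Finset.eq_of_subset_of_card_le hqE (by omega)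
  have halt : ∀ e ∈ E, 0 < (-1) ^ #(E.filter (e < ·)) * q.leadingCoeff * q.coeff e := by
    intro e he
    rw [← hsupp] at he ⊢
    exact alternating_of_signVariations (by omega) he
  have hEm : ∀ s, s ≤ #X - 1 → 0 < q.coeff (m + 2 * s) := by
    intro s hs
    have h := halt (m + 2 * s) (by simp [hE]; omega)
    have : E.filter (m + 2 * s < ·) = Finset.Ioc (m + 2 * s) (m + 2 * (#X - 1)) := by
      ext j
      simp only [hE, Finset.mem_filter, Finset.mem_union, Finset.mem_insert,
        Finset.mem_singleton, Finset.mem_Icc, Finset.mem_Ioc]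
      omega
    rw [this, Nat.card_Ioc, Even.neg_one_pow ⟨#X - 1 - s, by omega⟩, one_mul] at h
    exact (pos_iff_pos_of_mul_pos h).1 hlead
  refine ⟨q, hqE, hq1, ?_, ?_, hEm _ le_rfl⟩
  · intro y hy hyX
    have hglead : 0 < g.leadingCoeff := by
      rw [hg, leadingCoeff_monic_mul hDmonic] at hlead
      exact hlead
    have hgroot : ∀ z, 0 < z → g.eval z ≠ 0 := by
      intro z hz hz0
      have : 0 < g.roots.countP (0 < ·) :=
        Multiset.countP_pos_of_mem ((mem_roots hg0).2 hz0) hz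
      omega
    rw [hg, eval_mul]
    refine mul_pos ?_ (eval_pos_of_no_pos_roots hglead hgroot hy)
    rw [hD, eval_prod]
    refine Finset.prod_pos fun z hz => ?_
    have : y - z ≠ 0 := by
      intro h
      rw [sub_eq_zero] at h
      exact hyX (h ▸ hz)
    simp only [eval_pow, eval_sub, eval_X, eval_C]
    positivity
  · simpa using hEm 0 (Nat.zero_le _)

end SparsePolynomials

section Perturbation

open Topology

/-- If a family of functionals `L τ k` depends continuously on `τ` and, at `τ = 0`, the
functionals indexed by `A` are independent, then a solution of `L 0 k u = 0` (`k ∈ A`),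
`0 < L 0 k u` (`k ∉ A`) persists for small `τ`. -/
lemma eventually_exists_of_surjective_at_zero {U K : Type*} [AddCommGroup U] [Module ℝ U]
    [Fintype K] [DecidableEq K] (L : ℝ → K → U →ₗ[ℝ] ℝ)
    (hL : ∀ k u, Continuous fun τ => L τ k u) (A : Finset K) (u₀ : U)
    (hzero : ∀ k ∈ A, L 0 k u₀ = 0) (hpos : ∀ k ∉ A, 0 < L 0 k u₀)
    (hsurj : ∀ v : K → ℝ, ∃ u, ∀ k ∈ A, L 0 k u = v k) :
    ∀ᶠ τ in 𝓝 (0 : ℝ), ∃ u, (∀ k ∈ A, L τ k u = 0) ∧ ∀ k ∉ A, 0 < L τ k u := by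
  choose b hb using fun a : K => hsurj (Pi.single a 1)
  let N : ℝ → Matrix A A ℝ := fun τ => Matrix.of fun k a => L τ k (b a)
  let r : ℝ → A → ℝ := fun τ k => L τ k u₀
  let w : ℝ → A → ℝ := fun τ => Matrix.mulVec (N τ).adjugate (r τ)
  let u : ℝ → U := fun τ => (N τ).det • u₀ - ∑ a : A, w τ a • b a
  have hN : Continuous N := continuous_matrix fun k a => hL k (b a)
  have hr : Continuous r := continuous_pi fun k => hL k u₀
  have hw : Continuous w := hN.matrix_adjugate.matrix_mulVec hr
  have hLu : ∀ τ k, L τ k (u τ) = (N τ).det * L τ k u₀ - ∑ a : A, w τ a * L τ k (b a) := by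
    intro τ k
    simp [u]
  have hcont : ∀ k, Continuous fun τ => L τ k (u τ) := by
    intro k
    simp only [hLu]
    refine (hN.matrix_det.mul (hL k u₀)).sub (continuous_finsetSum _ fun a _ => ?_)
    exact ((continuous_apply a).comp hw).mul (hL k (b a))
  have hN0 : N 0 = 1 := by
    ext k a
    change L 0 k (b a) = _
    rw [hb a k k.2, Matrix.one_apply, Pi.single_apply]
    simp only [Subtype.ext_iff]
  have hr0 : r 0 = 0 := funext fun k => hzero k k.2
  have hu0 : u 0 = u₀ := by simp [u, w, hN0, hr0]
  have hev : ∀ᶠ τ in 𝓝 (0 : ℝ), ∀ k, k ∉ A → 0 < L τ k (u τ) := by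
    rw [Filter.eventually_all]
    intro k
    by_cases hk : k ∈ A
    · simp [hk]
    · have h0 : 0 < L 0 k (u 0) := by rw [hu0]; exact hpos k hk
      filter_upwards [(hcont k).continuousAt.eventually_const_lt h0] with τ hτ _ using hτ
  filter_upwards [hev] with τ hτ
  refine ⟨u τ, fun k hk => ?_, hτ⟩
  have h1 : Matrix.mulVec (N τ) (w τ) ⟨k, hk⟩ = (N τ).det * L τ k u₀ := by
    simp only [w]
    rw [Matrix.mulVec_mulVec, Matrix.mul_adjugate, Matrix.smul_mulVec, Matrix.one_mulVec]
    rfl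
  rw [hLu, ← h1, sub_eq_zero]
  simp only [Matrix.mulVec, dotProduct, N, Matrix.of_apply]
  exact Finset.sum_congr rfl fun a _ => mul_comm _ _

end Perturbation

section Scaling

open Polynomial Topology

/-- The order of `τ` in the coefficient of `t ^ j`. -/
def coeffOrder (m₁ m₂ j : ℕ) : ℕ :=
  if j = 1 then m₁ + m₂ - 2 else if j = 2 then m₂ - 2 else if j = 3 then 0
  else max (m₂ - j) (m₁ + m₂ - 2 * j)

/-- The order of `τ` in the values taken on the `i`-th curve. -/
def curveOrder (m₁ m₂ : ℕ) (i : Fin 3) : ℕ :=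
  if i = 0 then m₁ + m₂ else if i = 1 then m₂ else 0

/-- The order of `τ` in the term of degree `j` on the `i`-th curve, relative to
`curveOrder`. -/
def relOrder (M m₁ m₂ : ℕ) (i : Fin 3) (j : ℕ) : ℕ :=
  coeffOrder m₁ m₂ j + (2 - (i : ℕ)) * j + (if j ≤ 3 ∧ j ≠ (i : ℕ) + 1 then M else 0) -
    curveOrder m₁ m₂ i

lemma relOrder_add_curveOrder {M m₁ m₂ j : ℕ} (i : Fin 3) (hj : 1 ≤ j) (h₁ : 4 ≤ m₁)
    (h₁₂ : m₁ ≤ m₂) (hM : m₁ + m₂ ≤ M) :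
    relOrder M m₁ m₂ i j + curveOrder m₁ m₂ i =
      coeffOrder m₁ m₂ j + (2 - (i : ℕ)) * j +
        (if j ≤ 3 ∧ j ≠ (i : ℕ) + 1 then M else 0) := by
  fin_cases i <;> simp [relOrder, curveOrder, coeffOrder] <;> split_ifs <;> omega

lemma relOrder_eq_zero_iff {M m₁ m₂ j : ℕ} (i : Fin 3) (hj : 1 ≤ j) (h₁ : 4 ≤ m₁)
    (h₁₂ : m₁ ≤ m₂) (hM : m₁ + m₂ < M) :
    relOrder M m₁ m₂ i j = 0 ↔ j = (i : ℕ) + 1 ∨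
      (4 ≤ j ∧ (i = 0 → j ≤ m₁) ∧ (i = 1 → m₁ ≤ j ∧ j ≤ m₂) ∧ (i = 2 → m₂ ≤ j)) := by
  fin_cases i <;> simp [relOrder, curveOrder, coeffOrder] <;> split_ifs <;> omega

/-- The rescaled value at the parameter `y` of the `i`-th curve of the affine functional with
rescaled coefficients `u`. -/
def scaledEval (d M m₁ m₂ : ℕ) (τ : ℝ) (i : Fin 3) (y : ℝ) :
    ((Fin 3 → ℝ) × (ℕ → ℝ)) →ₗ[ℝ] ℝ :=
  LinearMap.proj i ∘ₗ LinearMap.fst ℝ _ _ +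
    ∑ j ∈ Finset.Icc 1 d, (τ ^ relOrder M m₁ m₂ i j * y ^ j) •
      (LinearMap.proj j ∘ₗ LinearMap.snd ℝ (Fin 3 → ℝ) (ℕ → ℝ))

lemma scaledEval_apply (d M m₁ m₂ : ℕ) (τ : ℝ) (i : Fin 3) (y : ℝ)
    (u : (Fin 3 → ℝ) × (ℕ → ℝ)) :
    scaledEval d M m₁ m₂ τ i y u =
      u.1 i + ∑ j ∈ Finset.Icc 1 d, τ ^ relOrder M m₁ m₂ i j * y ^ j * u.2 j := by
  simp [scaledEval]

/-- Three polynomials that agree on their common exponents arise from one functional at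
`τ = 0`. -/
lemma exists_scaledEval_zero_eq {d M m₁ m₂ : ℕ} (h₁ : 4 ≤ m₁) (h₁₂ : m₁ ≤ m₂) (h₂ : m₂ ≤ d)
    (hM : m₁ + m₂ < M) (q : Fin 3 → ℝ[X])
    (hq0 : (q 0).support ⊆ {0, 1} ∪ Finset.Icc 4 m₁)
    (hq1 : (q 1).support ⊆ {0, 2} ∪ Finset.Icc m₁ m₂)
    (hq2 : (q 2).support ⊆ {0, 3} ∪ Finset.Icc m₂ d)
    (h01 : (q 0).coeff m₁ = (q 1).coeff m₁) (h12 : (q 1).coeff m₂ = (q 2).coeff m₂) :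
    ∃ u, ∀ i y, scaledEval d M m₁ m₂ 0 i y u = (q i).eval y := by
  have hs0 : ∀ j, (q 0).coeff j ≠ 0 → j = 0 ∨ j = 1 ∨ 4 ≤ j ∧ j ≤ m₁ := by
    intro j hj
    simpa using hq0 (mem_support_iff.2 hj)
  have hs1 : ∀ j, (q 1).coeff j ≠ 0 → j = 0 ∨ j = 2 ∨ m₁ ≤ j ∧ j ≤ m₂ := by
    intro j hj
    simpa using hq1 (mem_support_iff.2 hj)
  have hs2 : ∀ j, (q 2).coeff j ≠ 0 → j = 0 ∨ j = 3 ∨ m₂ ≤ j ∧ j ≤ d := by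
    intro j hj
    simpa using hq2 (mem_support_iff.2 hj)
  let c : ℕ → ℝ := fun j =>
    if j = 1 then (q 0).coeff j else if j = 2 then (q 1).coeff j
    else if j = 3 then (q 2).coeff j else if j ≤ m₁ then (q 0).coeff j
    else if j ≤ m₂ then (q 1).coeff j else (q 2).coeff j
  refine ⟨(fun i => (q i).coeff 0, c), fun i y => ?_⟩
  have hdeg : (q i).natDegree < d + 1 := by
    rw [Nat.lt_succ_iff, natDegree_le_iff_coeff_eq_zero]
    intro j hj
    by_contra hne
    fin_cases i
    · have := hs0 j hne; omega
    · have := hs1 j hne; omega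
    · have := hs2 j hne; omega
  rw [scaledEval_apply, eval_eq_sum_range' hdeg, Finset.range_eq_Ico,
    Finset.sum_eq_sum_Ico_succ_bot (Nat.succ_pos d)]
  simp only [pow_zero, mul_one, zero_add]
  congr 1
  refine Finset.sum_congr (by ext j; simp) fun j hj => ?_
  have hj1 : 1 ≤ j := by simp at hj; omega
  rw [mul_right_comm, zero_pow_eq]
  congr 1
  have hiff := relOrder_eq_zero_iff i hj1 h₁ h₁₂ hM
  split_ifs with h0
  · rw [hiff] at h0
    rw [one_mul]
    fin_cases i <;> simp only [c] <;> simp at h0 ⊢ <;> split_ifs <;> grind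
  · rw [hiff] at h0
    rw [zero_mul]
    by_contra hne
    fin_cases i
    · have := hs0 j (Ne.symm hne); simp at h0; omega
    · have := hs1 j (Ne.symm hne); simp at h0; omega
    · have := hs2 j (Ne.symm hne); simp at h0; omega

end Scaling

section Supporting

open Polynomial Topology

/-- A transversal set `A` of at most `(d + 2) / 2` parameters is, for small `τ`, the zero set of
an affine functional that is positive at all other parameters. -/
lemma eventually_exists_supporting {d : ℕ} {n : Fin 3 → ℕ}
    {x : (i : Fin 3) → Fin (n i) → ℝ} (hxpos : ∀ i j, 0 < x i j)
    (hxinj : ∀ i, Function.Injective (x i)) {M : ℕ} (hM : 2 * d < M)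
    (A : Finset (Σ i, Fin (n i))) (hA : ∀ i, ∃ j, (⟨i, j⟩ : Σ i, Fin (n i)) ∈ A)
    (hcard : #A ≤ (d + 2) / 2) :
    ∀ᶠ τ in 𝓝[>] (0 : ℝ), ∃ (α : Fin 3 → ℝ) (c : ℕ → ℝ), ∀ k : Σ i, Fin (n i),
      (k ∈ A → α k.1 + ∑ j ∈ Finset.Icc 1 d, c j *
        ((if j ≤ 3 ∧ j ≠ (k.1 : ℕ) + 1 then τ ^ M else 1) *
          (x k.1 k.2 * τ ^ (2 - (k.1 : ℕ))) ^ j) = 0) ∧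
      (k ∉ A → 0 < α k.1 + ∑ j ∈ Finset.Icc 1 d, c j *
        ((if j ≤ 3 ∧ j ≠ (k.1 : ℕ) + 1 then τ ^ M else 1) *
          (x k.1 k.2 * τ ^ (2 - (k.1 : ℕ))) ^ j)) := by
  let B : (i : Fin 3) → Finset (Fin (n i)) := fun i => univ.filter fun j => ⟨i, j⟩ ∈ A
  let X : Fin 3 → Finset ℝ := fun i => (B i).image (x i)
  have hmemX : ∀ i j, x i j ∈ X i ↔ (⟨i, j⟩ : Σ i, Fin (n i)) ∈ A := by
    intro i j
    simp [X, B, (hxinj i).eq_iff]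
  have hXpos : ∀ i, ∀ y ∈ X i, 0 < y := by
    intro i y hy
    obtain ⟨j, -, rfl⟩ := Finset.mem_image.1 hy
    exact hxpos i j
  have hXne : ∀ i, (X i).Nonempty := by
    intro i
    obtain ⟨j, hj⟩ := hA i
    exact ⟨x i j, (hmemX i j).2 hj⟩
  have hXcard : #(X 0) + #(X 1) + #(X 2) = #A := by
    have hAB : A = univ.sigma B := by
      ext ⟨i, j⟩
      simp [B]
    rw [hAB, Finset.card_sigma, Fin.sum_univ_three]
    simp only [X, Finset.card_image_of_injective _ (hxinj _)]
  have hX0 := (hXne 0).card_pos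
  have hX1 := (hXne 1).card_pos
  have hX2 := (hXne 2).card_pos
  obtain ⟨m₀, m₁, m₂, hm0, h01, h12, h2d⟩ : ∃ m₀ m₁ m₂ : ℕ, 4 ≤ m₀ ∧
      m₁ = m₀ + 2 * (#(X 0) - 1) ∧ m₂ = m₁ + 2 * (#(X 1) - 1) ∧ d = m₂ + 2 * (#(X 2) - 1) :=
    ⟨d + 6 - 2 * #A, _, _, by omega, rfl, rfl, by omega⟩
  have hm1 : 4 ≤ m₁ := by omega
  have hm12 : m₁ ≤ m₂ := by omega
  have hm2 : m₂ ≤ d := by omega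
  have hmM : m₁ + m₂ < M := by omega
  let L : ℝ → (Σ i, Fin (n i)) → ((Fin 3 → ℝ) × (ℕ → ℝ)) →ₗ[ℝ] ℝ :=
    fun τ k => scaledEval d M m₁ m₂ τ k.1 (x k.1 k.2)
  obtain ⟨q0, hq0s, hq0z, hq0p, hq0l, hq0r⟩ :=
    exists_sparse_double_roots 1 m₀ (by norm_num) (by omega) (X 0) (hXpos 0) (hXne 0)
  obtain ⟨q1, hq1s, hq1z, hq1p, hq1l, hq1r⟩ :=
    exists_sparse_double_roots 2 m₁ (by norm_num) (by omega) (X 1) (hXpos 1) (hXne 1)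
  obtain ⟨q2, hq2s, hq2z, hq2p, hq2l, hq2r⟩ :=
    exists_sparse_double_roots 3 m₂ (by norm_num) (by omega) (X 2) (hXpos 2) (hXne 2)
  rw [← h01] at hq0s hq0r
  rw [← h12] at hq1s hq1r
  rw [← h2d] at hq2s hq2r
  set s1 : ℝ := q2.coeff m₂ / q1.coeff m₂ with hs1
  have hs1p : 0 < s1 := div_pos hq2l hq1r
  set s0 : ℝ := s1 * q1.coeff m₁ / q0.coeff m₁ with hs0
  have hs0p : 0 < s0 := div_pos (mul_pos hs1p hq1l) hq0r
  obtain ⟨u₀, hu₀⟩ := exists_scaledEval_zero_eq hm1 hm12 hm2 hmM ![s0 • q0, s1 • q1, q2]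
    ((support_smul _ _).trans (hq0s.trans (Finset.union_subset_union_right
      (Finset.Icc_subset_Icc_left hm0))))
    ((support_smul _ _).trans hq1s) hq2s
    (by simp [hs0, hq0r.ne']) (by simp [hs1, hq1r.ne'])
  have hzero : ∀ k ∈ A, L 0 k u₀ = 0 := by
    rintro ⟨i, j⟩ hk
    have hx := (hmemX i j).2 hk
    simp only [L, hu₀]
    fin_cases i
    · simpa using Or.inr (hq0z _ hx)
    · simpa using Or.inr (hq1z _ hx)
    · simpa using hq2z _ hx
  have hpos : ∀ k ∉ A, 0 < L 0 k u₀ := by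
    rintro ⟨i, j⟩ hk
    have hx := mt (hmemX i j).1 hk
    have hxp := hxpos i j
    simp only [L, hu₀]
    fin_cases i
    · simpa using mul_pos hs0p (hq0p _ hxp hx)
    · simpa using mul_pos hs1p (hq1p _ hxp hx)
    · simpa using hq2p _ hxp hx
  have hsurj : ∀ v : (Σ i, Fin (n i)) → ℝ, ∃ u, ∀ k ∈ A, L 0 k u = v k := by
    intro v
    have hv : ∀ i, ∃ f : ℝ → ℝ, ∀ j, f (x i j) = v ⟨i, j⟩ := fun i =>
      ⟨Function.extend (x i) (fun j => v ⟨i, j⟩) 0, fun j => (hxinj i).extend_apply _ _ j⟩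
    choose f hf using hv
    have hinterp : ∀ i m, 1 ≤ m → ∃ q : ℝ[X],
        q.support ⊆ insert 0 (Finset.Ioo m (m + #(X i))) ∧ ∀ y ∈ X i, q.eval y = f i y := by
      intro i m hm
      refine exists_sparse_interpolation _ (X i) (hXpos i) ?_ (f i)
      have := (hXne i).card_pos
      rw [Finset.card_insert_of_notMem (by simp), Nat.card_Ioo]
      omega
    have hsub : ∀ {q : ℝ[X]} {m s a : ℕ}, 1 ≤ s →
        q.support ⊆ insert 0 (Finset.Ioo m (m + s)) →
          q.support ⊆ {0, a} ∪ Finset.Icc m (m + 2 * (s - 1)) := by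
      intro q m s a hs hq j hj
      have := hq hj
      simp only [Finset.mem_insert, Finset.mem_Ioo, Finset.mem_union, Finset.mem_singleton,
        Finset.mem_Icc] at this ⊢
      omega
    have hcoeff : ∀ {q : ℝ[X]} {m s : ℕ}, 1 ≤ s → 1 ≤ m →
        q.support ⊆ insert 0 (Finset.Ioo m (m + s)) →
          q.coeff m = 0 ∧ q.coeff (m + 2 * (s - 1)) = 0 := by
      intro q m s hs hm hq
      constructor <;>
      · by_contra hne
        have := hq (mem_support_iff.2 hne)
        simp only [Finset.mem_insert, Finset.mem_Ioo] at this
        omega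
    obtain ⟨p0, hp0s, hp0⟩ := hinterp 0 m₀ (by omega)
    obtain ⟨p1, hp1s, hp1⟩ := hinterp 1 m₁ (by omega)
    obtain ⟨p2, hp2s, hp2⟩ := hinterp 2 m₂ (by omega)
    have hc0 := hcoeff hX0 (by omega) hp0s
    have hc1 := hcoeff hX1 (by omega) hp1s
    have hc2 := hcoeff hX2 (by omega) hp2s
    have hp0s' := hsub (a := 1) hX0 hp0s
    have hp1s' := hsub (a := 2) hX1 hp1s
    have hp2s' := hsub (a := 3) hX2 hp2s
    rw [← h01] at hc0 hp0s'
    rw [← h12] at hc1 hp1s'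
    rw [← h2d] at hc2 hp2s'
    obtain ⟨u, hu⟩ := exists_scaledEval_zero_eq hm1 hm12 hm2 hmM ![p0, p1, p2]
      (hp0s'.trans (Finset.union_subset_union_right (Finset.Icc_subset_Icc_left hm0)))
      hp1s' hp2s' (hc0.2.trans hc1.1.symm) (hc1.2.trans hc2.1.symm)
    refine ⟨u, ?_⟩
    rintro ⟨i, j⟩ hk
    have hx := (hmemX i j).2 hk
    simp only [L, hu, ← hf]
    fin_cases i
    · exact hp0 _ hx
    · exact hp1 _ hx
    · exact hp2 _ hx
  have hcont : ∀ k u, Continuous fun τ => L τ k u := by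
    intro k u
    simp only [L, scaledEval_apply]
    fun_prop
  have hev := eventually_exists_of_surjective_at_zero L hcont A u₀ hzero hpos hsurj
  filter_upwards [nhdsWithin_le_nhds hev, self_mem_nhdsWithin] with τ ⟨u, huz, hup⟩ hτ
  have hτ : 0 < τ := hτ
  refine ⟨fun i => τ ^ curveOrder m₁ m₂ i * u.1 i, fun j => τ ^ coeffOrder m₁ m₂ j * u.2 j,
    fun k => ?_⟩
  have hval : τ ^ curveOrder m₁ m₂ k.1 * u.1 k.1 +
      ∑ j ∈ Finset.Icc 1 d, τ ^ coeffOrder m₁ m₂ j * u.2 j *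
        ((if j ≤ 3 ∧ j ≠ (k.1 : ℕ) + 1 then τ ^ M else 1) *
          (x k.1 k.2 * τ ^ (2 - (k.1 : ℕ))) ^ j) = τ ^ curveOrder m₁ m₂ k.1 * L τ k u := by
    simp only [L, scaledEval_apply]
    rw [mul_add, Finset.mul_sum]
    congr 1
    refine Finset.sum_congr rfl fun j hj => ?_
    have hj1 : 1 ≤ j := (Finset.mem_Icc.1 hj).1
    have hadd := relOrder_add_curveOrder k.1 hj1 hm1 hm12 hmM.le
    have hpow : τ ^ relOrder M m₁ m₂ k.1 j * τ ^ curveOrder m₁ m₂ k.1 =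
        τ ^ coeffOrder m₁ m₂ j * (τ ^ (2 - (k.1 : ℕ))) ^ j *
          (if j ≤ 3 ∧ j ≠ (k.1 : ℕ) + 1 then τ ^ M else 1) := by
      rw [← pow_add, hadd, pow_add, pow_add, pow_mul]
      split_ifs <;> simp
    rw [mul_pow]
    linear_combination (-(x k.1 k.2 ^ j * u.2 j)) * hpow
  simp only [hval]
  refine ⟨fun hk => by rw [huz k hk, mul_zero], fun hk => mul_pos (by positivity) (hup k hk)⟩

end Supporting

section FaceCounting

/-- An exposed face of a polytope is spanned by the generators it contains. -/
lemma IsExposed.eq_convexHull_image {D : ℕ} {K : Type*} [Finite K] {v : K → Vec D}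
    {F : Set (Vec D)} (hF : IsExposed ℝ (convexHull ℝ (Set.range v)) F) :
    F = convexHull ℝ (v '' {k | v k ∈ F}) := by
  have hcompact : IsCompact (convexHull ℝ (Set.range v)) :=
    (Set.finite_range v).isCompact_convexHull ℝ
  have hconv : Convex ℝ F := hF.convex (convex_convexHull ℝ _)
  refine Set.Subset.antisymm ?_ (convexHull_min ?_ hconv)
  · have hclosed : IsClosed (convexHull ℝ (v '' {k | v k ∈ F})) :=
      ((Set.toFinite _).image v).isClosed_convexHull ℝ
    conv_lhs => rw [← closure_convexHull_extremePoints (hF.isCompact hcompact) hconv]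
    refine closure_minimal (convexHull_mono ?_) hclosed
    rw [hF.isExtreme.extremePoints_eq]
    rintro y ⟨hyF, hy⟩
    obtain ⟨k, rfl⟩ := extremePoints_convexHull_subset hy
    exact ⟨k, hyF, rfl⟩
  · rintro _ ⟨k, hk, rfl⟩
    exact hk

/-- `U` is the set of generators lying on a supporting hyperplane. -/
def IsSupported {D : ℕ} {K : Type*} (v : K → Vec D) (U : Finset K) : Prop :=
  ∃ (l : Vec D →ₗ[ℝ] ℝ) (b : ℝ), (∀ k ∈ U, l (v k) = b) ∧ ∀ k ∉ U, l (v k) < b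

lemma IsSupported.isExposed {D : ℕ} {K : Type*} [Finite K] {v : K → Vec D} {U : Finset K}
    (h : IsSupported v U) (hU : U.Nonempty) :
    IsExposed ℝ (convexHull ℝ (Set.range v)) (convexHull ℝ (v '' U)) ∧
      ∀ k, v k ∈ convexHull ℝ (v '' U) ↔ k ∈ U := by
  obtain ⟨l, b, hl, hlt⟩ := h
  have hle : ∀ y ∈ convexHull ℝ (Set.range v), l y ≤ b := by
    intro y hy
    refine convexHull_min (t := {y | l y ≤ b}) ?_ (convex_halfSpace_le l.isLinear b) hy
    rintro _ ⟨k, rfl⟩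
    by_cases hk : k ∈ U
    · exact (hl k hk).le
    · exact (hlt k hk).le
  set F := (LinearMap.toContinuousLinearMap l).toExposed (convexHull ℝ (Set.range v)) with hFdef
  have hF : IsExposed ℝ (convexHull ℝ (Set.range v)) F :=
    ContinuousLinearMap.toExposed.isExposed
  have hmem : ∀ k, v k ∈ F ↔ k ∈ U := by
    intro k
    have hkC : v k ∈ convexHull ℝ (Set.range v) := subset_convexHull ℝ _ ⟨k, rfl⟩
    constructor
    · intro hk
      by_contra hkU
      obtain ⟨u, hu⟩ := hU
      have h1 : l (v u) ≤ l (v k) := hk.2 (v u) (subset_convexHull ℝ _ ⟨u, rfl⟩)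
      rw [hl u hu] at h1
      exact absurd (hlt k hkU) (not_lt.2 h1)
    · intro hkU
      refine ⟨hkC, fun y hy => ?_⟩
      change l y ≤ l (v k)
      rw [hl k hkU]
      exact hle y hy
  have hset : {k | v k ∈ F} = (U : Set K) := Set.ext hmem
  have hFeq := hF.eq_convexHull_image
  rw [hset] at hFeq
  rw [← hFeq]
  exact ⟨hF, hmem⟩

lemma sdim_convexHull_image {D : ℕ} {K : Type*} {v : K → Vec D} {U : Finset K}
    (hU : U.Nonempty) :
    sdim (convexHull ℝ (v '' U)) = Module.finrank ℝ (vectorSpan ℝ (v '' U)) := by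
  have : convexHull ℝ (v '' U) ≠ ∅ := by
    rw [← Set.nonempty_iff_ne_empty, convexHull_nonempty_iff]
    exact Set.Nonempty.image v (Finset.coe_nonempty.2 hU)
  rw [sdim, if_neg this, affineSpan_convexHull, direction_affineSpan]

/-- If all transversal sets of at most `r` generators are supported, the faces of dimension
`k - 1` meeting all colours correspond to the transversal sets of `k ≤ r` generators. -/
lemma card_transversal_faces {D : ℕ} {K : Type*} [Fintype K] [DecidableEq K] {v : K → Vec D}
    {col : K → Fin 3} {r k : ℕ} (hk : 3 ≤ k) (hkr : k ≤ r) (hK : r < Fintype.card K)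
    (hsep : ∀ U : Finset K, (∀ i, ∃ a ∈ U, col a = i) → #U ≤ r → IsSupported v U)
    (hcol : ∀ i, ∃ (l : Vec D →ₗ[ℝ] ℝ) (b : ℝ),
      ∀ a, l (v a) = b + if col a = i then 1 else 0) :
    Nat.card {F : Set (Vec D) // (IsProperFace (convexHull ℝ (Set.range v)) F ∧
        ∀ i, ∃ a, col a = i ∧ v a ∈ F) ∧ sdim F = (k : ℤ) - 1} =
      #((univ : Finset (Finset K)).filter fun U => #U = k ∧ ∀ i, ∃ a ∈ U, col a = i) := by
  have hindep : ∀ U : Finset K, (∀ i, ∃ a ∈ U, col a = i) → #U = k →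
      AffineIndependent ℝ (fun a : U => v a) := by
    intro U hU hUk
    have hfun : ∀ e ∈ U, ∃ (l : Vec D →ₗ[ℝ] ℝ) (b : ℝ),
        (∀ a ∈ U, a ≠ e → l (v a) = b) ∧ l (v e) ≠ b := by
      intro e he
      by_cases hcase : ∃ a ∈ U, a ≠ e ∧ col a = col e
      · obtain ⟨a₀, ha₀, ha₀e, hcola₀⟩ := hcase
        obtain ⟨l, b, hl, hlt⟩ := hsep (U.erase e) (fun i => by
            obtain ⟨a, ha, rfl⟩ := hU i
            by_cases hae : a = e
            · exact ⟨a₀, Finset.mem_erase.2 ⟨ha₀e, ha₀⟩, by rw [hcola₀, hae]⟩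
            · exact ⟨a, Finset.mem_erase.2 ⟨hae, ha⟩, rfl⟩)
          ((Finset.card_erase_le).trans (by omega))
        exact ⟨l, b, fun a ha hae => hl a (Finset.mem_erase.2 ⟨hae, ha⟩),
          (hlt e (Finset.notMem_erase e U)).ne⟩
      · push Not at hcase
        obtain ⟨l, b, hl⟩ := hcol (col e)
        refine ⟨l, b, fun a ha hae => ?_, ?_⟩
        · rw [hl, if_neg (hcase a ha hae), add_zero]
        · rw [hl, if_pos rfl]
          simp
    rw [affineIndependent_iff]
    intro s w hw0 hw e he
    obtain ⟨l, b, hl, hle⟩ := hfun e e.2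
    have h1 : ∑ a ∈ s, w a * l (v a) = 0 := by
      have := congrArg l hw
      simpa using this
    have h2 : ∑ a ∈ s, w a * (l (v a) - b) = 0 := by
      simp only [mul_sub, Finset.sum_sub_distrib, h1, ← Finset.sum_mul, hw0]
      simp
    rw [Finset.sum_eq_single_of_mem e he] at h2
    · exact (mul_eq_zero.1 h2).resolve_right (sub_ne_zero.2 hle)
    · intro a _ hae
      rw [hl a a.2 (fun h => hae (Subtype.ext h)), sub_self, mul_zero]
  have hfinrank : ∀ U : Finset K, (∀ i, ∃ a ∈ U, col a = i) → #U = k →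
      Module.finrank ℝ (vectorSpan ℝ (v '' U)) = k - 1 := by
    intro U hU hUk
    have := (hindep U hU hUk).finrank_vectorSpan (n := k - 1) (by simp [hUk]; omega)
    rw [← this, Set.image_eq_range]
    rfl
  have hne : ∀ U : Finset K, (∀ i, ∃ a ∈ U, col a = i) → U.Nonempty := by
    intro U hU
    obtain ⟨a, ha, -⟩ := hU 0
    exact ⟨a, ha⟩
  rw [← Fintype.card_coe, ← Nat.card_eq_fintype_card]
  symm
  refine Nat.card_eq_of_bijective (fun U => ⟨convexHull ℝ (v '' U.1), ?_⟩) ⟨?_, ?_⟩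
  · obtain ⟨U, hU⟩ := U
    simp only [Finset.mem_filter, Finset.mem_univ, true_and] at hU
    obtain ⟨hUk, hU⟩ := hU
    obtain ⟨hexp, hmem⟩ := (hsep U hU (by omega)).isExposed (hne U hU)
    refine ⟨⟨⟨hexp, ?_, ?_⟩, ?_⟩, ?_⟩
    · rw [convexHull_nonempty_iff]
      exact Set.Nonempty.image v (Finset.coe_nonempty.2 (hne U hU))
    · intro heq
      obtain ⟨a, ha⟩ : ∃ a, a ∉ U := by
        by_contra hall
        push Not at hall
        rw [← Finset.eq_univ_iff_forall] at hall
        rw [hall, Finset.card_univ] at hUk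
        omega
      refine ha ((hmem a).1 ?_)
      rw [heq]
      exact subset_convexHull ℝ _ ⟨a, rfl⟩
    · intro i
      obtain ⟨a, ha, hai⟩ := hU i
      exact ⟨a, hai, (hmem a).2 ha⟩
    · rw [sdim_convexHull_image (hne U hU), hfinrank U hU hUk]
      omega
  · rintro ⟨U, hU⟩ ⟨W, hW⟩ hUW
    simp only [Finset.mem_filter, Finset.mem_univ, true_and] at hU hW
    simp only [Subtype.mk.injEq] at hUW ⊢
    obtain ⟨-, hUm⟩ := (hsep U hU.2 (by omega)).isExposed (hne U hU.2)
    obtain ⟨-, hWm⟩ := (hsep W hW.2 (by omega)).isExposed (hne W hW.2)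
    ext a
    rw [← hUm, ← hWm, hUW]
  · rintro ⟨F, ⟨⟨hexp, -, -⟩, hFcol⟩, hFdim⟩
    classical
    set W : Finset K := univ.filter fun a => v a ∈ F with hW
    have hWF : F = convexHull ℝ (v '' W) := by
      have := hexp.eq_convexHull_image
      simpa [hW] using this
    have hWcol : ∀ i, ∃ a ∈ W, col a = i := by
      intro i
      obtain ⟨a, hai, ha⟩ := hFcol i
      exact ⟨a, by simpa [hW] using ha, hai⟩
    rw [hWF, sdim_convexHull_image (hne W hWcol)] at hFdim
    have hWcard : k ≤ #W := by
      have hpos := (hne W hWcol).card_pos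
      have := finrank_vectorSpan_image_finset_le ℝ v W (n := #W - 1) (by omega)
      rw [Finset.coe_image] at this
      omega
    choose t ht htcol using hWcol
    obtain ⟨U, htU, hUW, hUk⟩ := Finset.exists_subsuperset_card_eq (s := univ.image t) (t := W)
      (n := k) (by
        intro a ha
        obtain ⟨i, -, rfl⟩ := Finset.mem_image.1 ha
        exact ht i)
      (Finset.card_image_le.trans (by simpa using hk)) hWcard
    have hU : ∀ i, ∃ a ∈ U, col a = i := fun i =>
      ⟨t i, htU (Finset.mem_image_of_mem t (Finset.mem_univ i)), htcol i⟩
    have hspan : vectorSpan ℝ (v '' U) = vectorSpan ℝ (v '' W) := by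
      refine Submodule.eq_of_le_of_finrank_eq
        (vectorSpan_mono ℝ (Set.image_mono (Finset.coe_subset.2 hUW))) ?_
      rw [hfinrank U hU hUk]
      omega
    obtain ⟨l, b, hl, hlt⟩ := hsep U hU (by omega)
    have hWU : W ⊆ U := by
      intro a ha
      by_contra haU
      obtain ⟨u, hu⟩ := hne U hU
      have hker : vectorSpan ℝ (v '' U) ≤ LinearMap.ker l := by
        rw [vectorSpan_def, Submodule.span_le]
        rintro _ ⟨_, ⟨p, hp, rfl⟩, _, ⟨q, hq, rfl⟩, rfl⟩
        simp [hl p hp, hl q hq]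
      have hmem : v a -ᵥ v u ∈ vectorSpan ℝ (v '' U) := by
        rw [hspan]
        exact vsub_mem_vectorSpan ℝ ⟨a, ha, rfl⟩ ⟨u, hUW hu, rfl⟩
      have h0 := hker hmem
      rw [LinearMap.mem_ker, vsub_eq_sub, map_sub, hl u hu] at h0
      linarith [hlt a haU]
    have hUeq : U = W := Finset.Subset.antisymm hUW hWU
    refine ⟨⟨U, by simpa using ⟨hUk, hU⟩⟩, ?_⟩
    simp only [Subtype.mk.injEq]
    rw [hWF, hUeq]

/-- The number of transversal `k`-subsets of three disjoint sets. -/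
lemma card_transversal_subsets (n : Fin 3 → ℕ) {k : ℕ} (hk : 0 < k) :
    (#((univ : Finset (Finset (Σ i, Fin (n i)))).filter
        fun U => #U = k ∧ ∀ i, ∃ a ∈ U, a.1 = i) : ℤ) =
      ∑ S ∈ (univ : Finset (Fin 3)).powerset.filter (· ≠ ∅),
        (-1 : ℤ) ^ (3 - #S) * ch (∑ j ∈ S, (n j : ℤ)) (k : ℤ) := by
  have hch : ∀ S : Finset (Fin 3),
      ch (∑ j ∈ S, (n j : ℤ)) (k : ℤ) = ((∑ j ∈ S, n j).choose k : ℕ) := by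
    intro S
    rw [ch, if_pos (by positivity), Int.toNat_natCast, ← Nat.cast_sum, Ring.choose_natCast]
  let A : Fin 3 → Finset (Finset (Σ i, Fin (n i))) :=
    fun i => univ.filter fun U => ∀ a ∈ U, a.1 ≠ i
  have hie := Finset.inclusion_exclusion_sum_inf_compl (univ : Finset (Fin 3)) A
    (fun U => if #U = k then (1 : ℤ) else 0)
  have hlhs : (∑ U ∈ univ.inf fun i => (A i)ᶜ, if #U = k then (1 : ℤ) else 0) =
      #((univ : Finset (Finset (Σ i, Fin (n i)))).filter
        fun U => #U = k ∧ ∀ i, ∃ a ∈ U, a.1 = i) := by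
    rw [Finset.sum_boole]
    congr 2
    ext U
    simp [A, Finset.mem_inf, and_comm]
  have hterm : ∀ t : Finset (Fin 3), (∑ U ∈ t.inf A, if #U = k then (1 : ℤ) else 0) =
      ((∑ j ∈ tᶜ, n j).choose k : ℕ) := by
    intro t
    have hcard : #(tᶜ.sigma fun i => (univ : Finset (Fin (n i)))) = ∑ j ∈ tᶜ, n j := by
      simp [Finset.card_sigma]
    rw [Finset.sum_boole, ← hcard, ← Finset.card_powersetCard]
    congr 2
    ext U
    simp only [A, Finset.mem_filter, Finset.mem_inf, Finset.mem_univ, true_and,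
      Finset.mem_powersetCard, Finset.subset_iff, Finset.mem_sigma, Finset.mem_compl, and_true]
    refine and_congr_left fun _ => ⟨fun h a ha hat => h _ hat a ha rfl, ?_⟩
    rintro h i hi a ha rfl
    exact h ha hi
  rw [← hlhs, hie]
  have hfilter : ∑ S ∈ (univ : Finset (Fin 3)).powerset.filter (· ≠ ∅),
      (-1 : ℤ) ^ (3 - #S) * ch (∑ j ∈ S, (n j : ℤ)) (k : ℤ) =
        ∑ S : Finset (Fin 3), (-1 : ℤ) ^ (3 - #S) * ch (∑ j ∈ S, (n j : ℤ)) (k : ℤ) := by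
    rw [Finset.powerset_univ]
    refine Finset.sum_filter_of_ne fun S _ hS => ?_
    rintro rfl
    refine hS ?_
    rw [hch]
    simp [Nat.choose_eq_zero_of_lt hk]
  rw [hfilter, Finset.powerset_univ]
  refine Fintype.sum_equiv (compl_involutive.toPerm _) _ _ fun t => ?_
  have hc : 3 - #(tᶜ) = #t := by
    have := Finset.card_add_card_compl t
    rw [Fintype.card_fin] at this
    omega
  rw [hterm, Function.Involutive.coe_toPerm, hch, hc, smul_eq_mul]

end FaceCounting

section Construction

/-- The points of the Cayley embedding of the construction, indexed by their parameters. -/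
def cayleyPoint (d : ℕ) {n : Fin 3 → ℕ} (x : (i : Fin 3) → Fin (n i) → ℝ) (M : ℕ) (τ : ℝ)
    (k : Σ i, Fin (n i)) : Vec (2 + d) :=
  cayEmb d k.1 (gamma3 d (τ ^ M) k.1 (x k.1 k.2 * τ ^ (2 - (k.1 : ℕ))))

lemma mem_VVtau_iff {d : ℕ} {n : Fin 3 → ℕ} {x : (i : Fin 3) → Fin (n i) → ℝ} {M : ℕ} {τ : ℝ}
    {i : Fin 3} {z : Vec (2 + d)} :
    z ∈ VVtau d n x M τ i ↔ ∃ j, cayleyPoint d x M τ ⟨i, j⟩ = z := by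
  simp [VVtau, Vtau, cayleyPoint]

lemma Ctau_eq_convexHull_range (d : ℕ) (n : Fin 3 → ℕ) (x : (i : Fin 3) → Fin (n i) → ℝ)
    (M : ℕ) (τ : ℝ) :
    Ctau d n x M τ = convexHull ℝ (Set.range (cayleyPoint d x M τ)) := by
  rw [Ctau]
  congr 1
  ext z
  simp only [Finset.coe_union, Set.mem_union, Finset.mem_coe, mem_VVtau_iff, Set.mem_range,
    Sigma.exists]
  constructor
  · rintro ((⟨j, h⟩ | ⟨j, h⟩) | ⟨j, h⟩)
    exacts [⟨0, j, h⟩, ⟨1, j, h⟩, ⟨2, j, h⟩]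
  · rintro ⟨i, j, h⟩
    fin_cases i
    exacts [.inl (.inl ⟨j, h⟩), .inl (.inr ⟨j, h⟩), .inr ⟨j, h⟩]

/-- The linear functional on the Cayley embedding with given coefficients. -/
def cayleyFunctional (d : ℕ) (α : Fin 3 → ℝ) (c : ℕ → ℝ) : Vec (2 + d) →ₗ[ℝ] ℝ :=
  (α 1 - α 0) • LinearMap.proj (Fin.castAdd d 0) + (α 2 - α 0) • LinearMap.proj (Fin.castAdd d 1)
    + ∑ j : Fin d, c (j + 1) • LinearMap.proj (Fin.natAdd 2 j)

lemma cayleyFunctional_cayleyPoint (d : ℕ) {n : Fin 3 → ℕ}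
    (x : (i : Fin 3) → Fin (n i) → ℝ) (M : ℕ) (τ : ℝ) (α : Fin 3 → ℝ) (c : ℕ → ℝ)
    (k : Σ i, Fin (n i)) :
    cayleyFunctional d α c (cayleyPoint d x M τ k) = α k.1 + ∑ j ∈ Finset.Icc 1 d, c j *
      ((if j ≤ 3 ∧ j ≠ (k.1 : ℕ) + 1 then τ ^ M else 1) *
        (x k.1 k.2 * τ ^ (2 - (k.1 : ℕ))) ^ j) - α 0 := by
  obtain ⟨i, j⟩ := k
  have hsum : ∀ f : ℕ → ℝ, ∑ j ∈ Finset.Icc 1 d, f j = ∑ j : Fin d, f (j + 1) := by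
    intro f
    rw [Fin.sum_univ_eq_sum_range (fun j => f (j + 1)), Finset.range_eq_Ico,
      Finset.sum_Ico_add' f 0 d 1]
    exact Finset.sum_congr (by ext j; simp) fun _ _ => rfl
  have he : (α 1 - α 0) * e2 i 0 + (α 2 - α 0) * e2 i 1 = α i - α 0 := by
    fin_cases i <;> simp [e2]
  simp only [cayleyFunctional, cayleyPoint, cayEmb, LinearMap.add_apply, LinearMap.smul_apply,
    LinearMap.sum_apply, LinearMap.proj_apply, Fin.append_left, Fin.append_right, smul_eq_mul,
    hsum, he, gamma3]
  rw [add_sub_right_comm]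
  congr 1
  refine Finset.sum_congr rfl fun j' _ => ?_
  congr 3
  simp

end Construction

/-- Lemma `lem:fkW3-tau`. In the moment-like curve construction with
`d ≥ 4`, there is `τ̂_{[3]} > 0` such that for all `τ ∈ (0, τ̂_{[3]})` and all
`3 ≤ k ≤ ⌊(d+2)/2⌋`, `f_{k-1}(ℱ_{[3]}) = ∑_{∅⊂S⊆[3]} (-1)^{3-|S|} C(n_S, k)`. -/
theorem moment_curve_construction_triple
    (d : ℕ) (hd : 4 ≤ d) (n : Fin 3 → ℕ) (hn : ∀ i, d + 1 ≤ n i)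
    (x : (i : Fin 3) → Fin (n i) → ℝ)
    (hxpos : ∀ i j, 0 < x i j) (hxmono : ∀ i, StrictMono (x i))
    (M : ℕ) (hM : d * (d + 1) ≤ M) :
    ∃ τ3 : ℝ, 0 < τ3 ∧ ∀ τ : ℝ, 0 < τ → τ < τ3 →
      ∀ k : ℕ, 3 ≤ k → k ≤ (d + 2) / 2 →
        (fsetCount (Ftau d n x M τ Finset.univ) ((k : ℤ) - 1) : ℤ) =
          ∑ S ∈ (Finset.univ : Finset (Fin 3)).powerset.filter (· ≠ ∅),
            (-1 : ℤ) ^ (3 - S.card) * ch (∑ j ∈ S, (n j : ℤ)) (k : ℤ) := by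
  classical
  have hMd : 2 * d < M := by nlinarith
  have hxinj : ∀ i, Function.Injective (x i) := fun i => (hxmono i).injective
  have hev : ∀ᶠ τ in nhdsWithin (0 : ℝ) (Set.Ioi 0), ∀ A : Finset (Σ i, Fin (n i)),
      (∀ i, ∃ a ∈ A, a.1 = i) → #A ≤ (d + 2) / 2 → IsSupported (cayleyPoint d x M τ) A := by
    rw [Filter.eventually_all]
    intro A
    by_cases hA : (∀ i, ∃ a ∈ A, a.1 = i) ∧ #A ≤ (d + 2) / 2
    · filter_upwards [eventually_exists_supporting hxpos hxinj hMd A (fun i => by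
        obtain ⟨⟨_, j⟩, ha, rfl⟩ := hA.1 i
        exact ⟨j, ha⟩) hA.2] with τ ⟨α, c, h⟩ _ _
      refine ⟨-cayleyFunctional d α c, α 0, fun k hk => ?_, fun k hk => ?_⟩
      · rw [LinearMap.neg_apply, cayleyFunctional_cayleyPoint, (h k).1 hk]
        ring
      · rw [LinearMap.neg_apply, cayleyFunctional_cayleyPoint]
        linarith [(h k).2 hk]
    · exact Filter.Eventually.of_forall fun τ h1 h2 => absurd ⟨h1, h2⟩ hA
  obtain ⟨τ3, hτ3, hsub⟩ := mem_nhdsGT_iff_exists_Ioo_subset.1 hev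
  refine ⟨τ3, hτ3, fun τ hτ hττ3 k hk hkd => ?_⟩
  have hsep := hsub ⟨hτ, hττ3⟩
  have hcard : (d + 2) / 2 < Fintype.card (Σ i, Fin (n i)) := by
    have := hn 0
    simp only [Fintype.card_sigma, Fintype.card_fin, Fin.sum_univ_three]
    omega
  have hcol : ∀ i : Fin 3, ∃ (l : Vec (2 + d) →ₗ[ℝ] ℝ) (b : ℝ), ∀ a : Σ i, Fin (n i),
      l (cayleyPoint d x M τ a) = b + if a.1 = i then 1 else 0 := by
    intro i
    refine ⟨cayleyFunctional d (Pi.single i 1) 0, -(Pi.single i 1 : Fin 3 → ℝ) 0, fun a => ?_⟩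
    rw [cayleyFunctional_cayleyPoint]
    simp [Pi.single_apply]
    ring
  rw [← card_transversal_subsets n (by omega),
    ← card_transversal_faces hk hkd hcard hsep hcol, fsetCount]
  congr 1
  refine Nat.card_congr (Equiv.subtypeEquivRight fun F => and_congr_left fun _ => ?_)
  rw [Ftau, Set.mem_ofPred_eq, Ctau_eq_convexHull_range]
  refine and_congr_right fun _ => ⟨fun h i => ?_, fun h i _ => ?_⟩
  · obtain ⟨z, hzF, hz⟩ := h i (Finset.mem_univ i)
    obtain ⟨j, rfl⟩ := mem_VVtau_iff.1 hz
    exact ⟨⟨i, j⟩, rfl, hzF⟩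
  · obtain ⟨⟨_, j⟩, rfl, hj⟩ := h i
    exact ⟨_, hj, mem_VVtau_iff.2 ⟨j, rfl⟩⟩
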